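/- Let λ < 0 and set α_n = (1+λ²)^{-1/2} (2 log n)^{-1/2} and β_n = (2 log n / (1+λ²))^{1/2} - (log log n + log(-2πλ)) / ((1+λ²)^{1/2} (2 log n)^{1/2}). Then for every real x, ((F_λ(α_n x + β_n))^n - Λ(x)) · 4 log n / (log log n)² → Λ(x) e^{-x} as n → ∞. -/

import Mathlib

open Real MeasureTheory Filter Topology

/-- Standard normal density. -/
noncomputable def stdPhi (x : ℝ) : ℝ := (Real.sqrt (2 * Real.pi))⁻¹ * Real.exp (-(x ^ 2) / 2)

/-- Standard normal cdf. -/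
noncomputable def stdCdf (x : ℝ) : ℝ := ∫ t in Set.Iic x, stdPhi t

/-- Skew normal density with shape parameter l. -/
noncomputable def snPdf (l x : ℝ) : ℝ := 2 * stdPhi x * stdCdf (l * x)

/-- Skew normal cdf with shape parameter l. -/
noncomputable def snCdf (l x : ℝ) : ℝ := ∫ t in Set.Iic x, snPdf l t

/-- Gumbel extreme value distribution function. -/
noncomputable def gumbel (x : ℝ) : ℝ := Real.exp (-Real.exp (-x))


lemma cdf_tendsto_atBot {f : ℝ → ℝ} (hf : Integrable f) :
    Tendsto (fun x => ∫ t in Set.Iic x, f t) atBot (𝓝 0) := by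
  have h := intervalIntegral_tendsto_integral_Iic 0 hf.integrableOn tendsto_id
  have : ∀ x, ∫ t in Set.Iic x, f t = (∫ t in Set.Iic 0, f t) - ∫ t in x..0, f t := by
    intro x
    rw [← intervalIntegral.integral_Iic_sub_Iic hf.integrableOn hf.integrableOn]; ring
  rw [funext this]
  simpa using h.const_sub (∫ t in Set.Iic 0, f t)

lemma cdf_tendsto_atTop {f : ℝ → ℝ} (hf : Integrable f) :
    Tendsto (fun x => ∫ t in Set.Iic x, f t) atTop (𝓝 (∫ t, f t)) := by
  have h := intervalIntegral_tendsto_integral_Ioi 0 hf.integrableOn tendsto_id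
  have : ∀ x, ∫ t in Set.Iic x, f t = (∫ t in Set.Iic 0, f t) + ∫ t in (0:ℝ)..x, f t := by
    intro x
    rw [← intervalIntegral.integral_Iic_sub_Iic hf.integrableOn hf.integrableOn]; ring
  rw [funext this]
  rw [← intervalIntegral.integral_Iic_add_Ioi (b := 0) hf.integrableOn hf.integrableOn]
  exact h.const_add (∫ t in Set.Iic 0, f t)

lemma cdf_hasDerivAt {f : ℝ → ℝ} (hf : Integrable f) (hc : Continuous f) (x : ℝ) :
    HasDerivAt (fun x => ∫ t in Set.Iic x, f t) (f x) x := by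
  have : ∀ x, ∫ t in Set.Iic x, f t = (∫ t in Set.Iic 0, f t) + ∫ t in (0:ℝ)..x, f t := by
    intro x
    rw [← intervalIntegral.integral_Iic_sub_Iic hf.integrableOn hf.integrableOn]; ring
  rw [funext this]
  exact (hc.integral_hasStrictDerivAt 0 x).hasDerivAt.const_add _

lemma nonpos_of_deriv {D D' : ℝ → ℝ} (hD : ∀ t, 0 < t → HasDerivAt D (D' t) t)
    (hD' : ∀ t, 0 < t → 0 ≤ D' t) (h0 : Tendsto D atTop (𝓝 0)) (z : ℝ) (hz : 0 < z) : D z ≤ 0 := by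
  have hm : MonotoneOn D (Set.Ici z) := by
    apply monotoneOn_of_deriv_nonneg (convex_Ici z)
    · intro t ht
      exact (hD t (lt_of_lt_of_le hz ht)).continuousAt.continuousWithinAt
    · intro t ht
      rw [interior_Ici] at ht
      exact (hD t (lt_trans hz ht)).differentiableAt.differentiableWithinAt
    · intro t ht
      rw [interior_Ici] at ht
      rw [(hD t (lt_trans hz ht)).deriv]
      exact hD' t (lt_trans hz ht)
  apply ge_of_tendsto h0
  filter_upwards [eventually_ge_atTop z] with t ht
  exact hm (Set.mem_Ici.2 le_rfl) ht ht

lemma stdPhi_cont : Continuous stdPhi := by unfold stdPhi; fun_prop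

lemma stdPhi_int : Integrable stdPhi := by
  have := (integrable_exp_neg_mul_sq (b := 1/2) (by norm_num)).const_mul (Real.sqrt (2 * Real.pi))⁻¹
  refine this.congr (ae_of_all _ fun x => ?_)
  simp only [stdPhi]; congr 2; ring

lemma stdPhi_integral : ∫ t, stdPhi t = 1 := by
  have : ∀ x, stdPhi x = (Real.sqrt (2 * Real.pi))⁻¹ * Real.exp (-(1/2) * x ^ 2) := by
    intro x; simp only [stdPhi]; congr 2; ring
  simp_rw [this]
  rw [integral_const_mul, integral_gaussian]
  rw [show π / (1/2) = 2 * π by ring]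
  have : √(2 * π) ≠ 0 := by positivity
  field_simp

lemma stdPhi_pos (x : ℝ) : 0 < stdPhi x := by
  unfold stdPhi; positivity

lemma stdPhi_neg (x : ℝ) : stdPhi (-x) = stdPhi x := by simp [stdPhi]

lemma stdPhi_deriv (x : ℝ) : HasDerivAt stdPhi (-x * stdPhi x) x := by
  have h : HasDerivAt (fun y : ℝ => -(y^2)/2) (-x) x := by
    have := ((hasDerivAt_pow 2 x).neg).div_const 2
    refine this.congr_deriv ?_
    simp; ring
  have := (h.exp).const_mul (Real.sqrt (2 * Real.pi))⁻¹
  refine this.congr_deriv ?_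
  unfold stdPhi; ring

lemma stdCdf_deriv (x : ℝ) : HasDerivAt stdCdf (stdPhi x) x :=
  cdf_hasDerivAt stdPhi_int stdPhi_cont x

lemma stdCdf_cont : Continuous stdCdf :=
  continuous_iff_continuousAt.2 fun x => (stdCdf_deriv x).continuousAt

lemma stdCdf_nonneg (x : ℝ) : 0 ≤ stdCdf x :=
  integral_nonneg fun t => (stdPhi_pos t).le

lemma stdCdf_symm (x : ℝ) : stdCdf x + stdCdf (-x) = 1 := by
  have h1 : stdCdf (-x) = ∫ t in Set.Ioi x, stdPhi t := by
    unfold stdCdf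
    rw [← integral_comp_neg_Ioi]
    simp_rw [stdPhi_neg]
  rw [h1, ← stdPhi_integral]
  exact intervalIntegral.integral_Iic_add_Ioi stdPhi_int.integrableOn stdPhi_int.integrableOn

lemma stdCdf_le_one (x : ℝ) : stdCdf x ≤ 1 := by
  linarith [stdCdf_symm x, stdCdf_nonneg (-x)]

lemma snPdf_cont (l : ℝ) : Continuous (snPdf l) := by
  unfold snPdf
  have := stdPhi_cont
  have := stdCdf_cont
  fun_prop

lemma snPdf_int (l : ℝ) : Integrable (snPdf l) := by
  refine (stdPhi_int.const_mul 2).mono' (snPdf_cont l).aestronglyMeasurable (ae_of_all _ fun x => ?_)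
  have h1 := stdPhi_pos x
  have h2 := stdCdf_nonneg (l * x)
  have h3 := stdCdf_le_one (l * x)
  rw [Real.norm_of_nonneg (by unfold snPdf; positivity)]
  unfold snPdf
  exact mul_le_of_le_one_right (by positivity) h3

lemma snPdf_integral (l : ℝ) : ∫ t, snPdf l t = 1 := by
  have h1 : ∫ t, snPdf l (-t) = ∫ t, snPdf l t := integral_neg_eq_self _ _
  have h2 : ∀ t, snPdf l t + snPdf l (-t) = 2 * stdPhi t := by
    intro t
    unfold snPdf
    rw [stdPhi_neg]
    have := stdCdf_symm (l * t)
    rw [show l * -t = -(l * t) by ring]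
    linear_combination 2 * stdPhi t * this
  have h3 : ∫ t, (snPdf l t + snPdf l (-t)) = 2 := by
    simp_rw [h2]; rw [integral_const_mul, stdPhi_integral]; norm_num
  rw [integral_add (snPdf_int l) (snPdf_int l).comp_neg, h1] at h3
  linarith

lemma stdPhi_tendsto : Tendsto stdPhi atTop (𝓝 0) := by
  have : Tendsto (fun x : ℝ => -(x^2)/2) atTop atBot := by
    have := (tendsto_pow_atTop (α := ℝ) (n := 2) two_ne_zero).const_mul_atTop (r := 1/2) (by norm_num)
    have := tendsto_neg_atTop_atBot.comp this
    refine this.congr fun x => ?_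
    simp; ring
  have := (tendsto_exp_atBot.comp this).const_mul (Real.sqrt (2 * Real.pi))⁻¹
  rw [mul_zero] at this
  exact this

lemma stdCdf_neg_tendsto : Tendsto (fun u => stdCdf (-u)) atTop (𝓝 0) :=
  (cdf_tendsto_atBot stdPhi_int).comp tendsto_neg_atTop_atBot

lemma stdCdf_neg_deriv (x : ℝ) : HasDerivAt (fun u => stdCdf (-u)) (-stdPhi x) x := by
  have := (stdCdf_deriv (-x)).comp x (hasDerivAt_neg x)
  rw [stdPhi_neg] at this
  exact this.congr_deriv (by ring)

lemma inv_pow_deriv (k : ℕ) (u : ℝ) (hu : 0 < u) :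
    HasDerivAt (fun u : ℝ => (u ^ k)⁻¹) (-k * (u ^ (k+1))⁻¹) u := by
  have := (hasDerivAt_pow k u).inv (by positivity)
  refine this.congr_deriv ?_
  rcases k with _ | k
  · simp
  · simp
    field_simp
    ring

lemma mills_upper (u : ℝ) (hu : 0 < u) : stdCdf (-u) ≤ stdPhi u * (u ^ 1)⁻¹ := by
  suffices h : stdCdf (-u) - stdPhi u * (u ^ 1)⁻¹ ≤ 0 by linarith
  refine nonpos_of_deriv (D := fun u => stdCdf (-u) - stdPhi u * (u ^ 1)⁻¹)
    (D' := fun u => stdPhi u * (u ^ 2)⁻¹) ?_ ?_ ?_ u hu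
  · intro t ht
    refine ((stdCdf_neg_deriv t).sub ((stdPhi_deriv t).mul (inv_pow_deriv 1 t ht))).congr_deriv ?_
    simp; field_simp; ring
  · intro t ht
    have := stdPhi_pos t
    positivity
  · have := stdCdf_neg_tendsto.sub (stdPhi_tendsto.mul (tendsto_pow_atTop (α := ℝ) (n := 1) one_ne_zero).inv_tendsto_atTop)
    simpa using this

lemma mills_lower (u : ℝ) (hu : 0 < u) : stdPhi u * ((u ^ 1)⁻¹ - (u^3)⁻¹) ≤ stdCdf (-u) := by
  suffices h : stdPhi u * ((u ^ 1)⁻¹ - (u^3)⁻¹) - stdCdf (-u) ≤ 0 by linarith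
  refine nonpos_of_deriv (D := fun u => stdPhi u * ((u ^ 1)⁻¹ - (u^3)⁻¹) - stdCdf (-u))
    (D' := fun u => 3 * stdPhi u * (u ^ 4)⁻¹) ?_ ?_ ?_ u hu
  · intro t ht
    refine (((stdPhi_deriv t).mul ((inv_pow_deriv 1 t ht).sub
      (inv_pow_deriv 3 t ht))).sub (stdCdf_neg_deriv t)).congr_deriv ?_
    simp; field_simp; ring
  · intro t ht
    have := stdPhi_pos t
    positivity
  · have := (stdPhi_tendsto.mul ((tendsto_pow_atTop (α := ℝ) (n := 1) one_ne_zero).inv_tendsto_atTop.sub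
      (tendsto_pow_atTop (α := ℝ) (n := 3) three_ne_zero).inv_tendsto_atTop)).sub stdCdf_neg_tendsto
    simpa using this

lemma snCdf_deriv (l x : ℝ) : HasDerivAt (snCdf l) (snPdf l x) x :=
  cdf_hasDerivAt (snPdf_int l) (snPdf_cont l) x

lemma snCdf_tendsto (l : ℝ) : Tendsto (snCdf l) atTop (𝓝 1) := by
  have := cdf_tendsto_atTop (snPdf_int l)
  rw [snPdf_integral] at this
  exact this

lemma phi_mul_phi (m t : ℝ) :
    2 * stdPhi t * stdPhi (m * t) = π⁻¹ * Real.exp (-((1 + m ^ 2) * t ^ 2) / 2) := by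
  unfold stdPhi
  have h : Real.exp (-((1 + m ^ 2) * t ^ 2) / 2)
      = Real.exp (-(t^2)/2) * Real.exp (-((m*t)^2)/2) := by
    rw [← Real.exp_add]; congr 1; ring
  have h2 : √(2 * π) * √(2 * π) = 2 * π := Real.mul_self_sqrt (by positivity)
  have h3 : (√(2 * π))⁻¹ * (√(2 * π))⁻¹ = (2 * π)⁻¹ := by rw [← mul_inv, h2]
  rw [h]
  have h4 : 2 * (2 * π)⁻¹ = π⁻¹ := by
    have := Real.pi_ne_zero
    field_simp
  rw [← h4, ← h3]; ring

lemma gauss_deriv (c x : ℝ) :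
    HasDerivAt (fun t : ℝ => Real.exp (-(c * t ^ 2) / 2)) (-(c * x) * Real.exp (-(c * x ^ 2) / 2)) x := by
  have h : HasDerivAt (fun y : ℝ => -(c * y^2)/2) (-(c * x)) x := by
    have := (((hasDerivAt_pow 2 x).const_mul c).neg).div_const 2
    refine this.congr_deriv ?_
    simp; ring
  exact h.exp.congr_deriv (by ring)

lemma gauss_tendsto (c : ℝ) (hc : 0 < c) :
    Tendsto (fun t : ℝ => Real.exp (-(c * t ^ 2) / 2)) atTop (𝓝 0) := by
  have : Tendsto (fun x : ℝ => -(c * x^2)/2) atTop atBot := by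
    have := (tendsto_pow_atTop (α := ℝ) (n := 2) two_ne_zero).const_mul_atTop (r := c/2) (by positivity)
    have := tendsto_neg_atTop_atBot.comp this
    refine this.congr fun x => ?_
    simp; ring
  exact tendsto_exp_atBot.comp this

lemma snPdf_upper (m t : ℝ) (hm : 0 < m) (ht : 0 < t) :
    snPdf (-m) t ≤ π⁻¹ * Real.exp (-((1 + m ^ 2) * t ^ 2) / 2) * (m * t)⁻¹ := by
  rw [← phi_mul_phi]
  have h := mills_upper (m * t) (by positivity)
  unfold snPdf
  rw [neg_mul]
  have := stdPhi_pos t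
  rw [pow_one] at h
  calc _ ≤ 2 * stdPhi t * (stdPhi (m * t) * (m * t)⁻¹) := by gcongr
    _ = _ := by ring

lemma snPdf_lower (m t : ℝ) (hm : 0 < m) (ht : 0 < t) :
    π⁻¹ * Real.exp (-((1 + m ^ 2) * t ^ 2) / 2) * ((m * t)⁻¹ - ((m * t)^3)⁻¹) ≤ snPdf (-m) t := by
  rw [← phi_mul_phi]
  have h := mills_lower (m * t) (by positivity)
  unfold snPdf
  rw [neg_mul]
  have := stdPhi_pos t
  rw [pow_one] at h
  calc _ = 2 * stdPhi t * (stdPhi (m * t) * ((m * t)⁻¹ - ((m * t)^3)⁻¹)) := by ring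
    _ ≤ _ := by gcongr

lemma tail_upper (m t : ℝ) (hm : 0 < m) (ht : 0 < t) :
    1 - snCdf (-m) t ≤ (π * m * (1 + m^2))⁻¹ *
      (Real.exp (-((1 + m ^ 2) * t ^ 2) / 2) * (t ^ 2)⁻¹) := by
  have hpi := Real.pi_pos
  suffices h : (1 - snCdf (-m) t) - (π * m * (1 + m^2))⁻¹ *
      (Real.exp (-((1 + m ^ 2) * t ^ 2) / 2) * (t ^ 2)⁻¹) ≤ 0 by linarith
  refine nonpos_of_deriv (D := fun t => (1 - snCdf (-m) t) - (π * m * (1 + m^2))⁻¹ *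
      (Real.exp (-((1 + m ^ 2) * t ^ 2) / 2) * (t ^ 2)⁻¹))
    (D' := fun t => π⁻¹ * Real.exp (-((1 + m ^ 2) * t ^ 2) / 2) * (m * t)⁻¹ - snPdf (-m) t
      + (π * m * (1 + m^2))⁻¹ * (Real.exp (-((1 + m ^ 2) * t ^ 2) / 2) * (2 * (t ^ 3)⁻¹)))
    ?_ ?_ ?_ t ht
  · intro t ht
    refine (((snCdf_deriv (-m) t).const_sub 1).sub
      (((gauss_deriv (1 + m^2) t).mul (inv_pow_deriv 2 t ht)).const_mul _)).congr_deriv ?_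
    simp; field_simp; ring
  · intro t ht
    have := snPdf_upper m t hm ht
    have : 0 ≤ (π * m * (1 + m^2))⁻¹ * (Real.exp (-((1 + m ^ 2) * t ^ 2) / 2) * (2 * (t ^ 3)⁻¹)) := by
      positivity
    linarith
  · have := ((snCdf_tendsto (-m)).const_sub 1).sub (((gauss_tendsto (1 + m^2) (by positivity)).mul
      (tendsto_pow_atTop (α := ℝ) (n := 2) two_ne_zero).inv_tendsto_atTop).const_mul
        (π * m * (1 + m^2))⁻¹)
    simpa using this

lemma tail_lower (m t : ℝ) (hm : 0 < m) (ht : 0 < t) :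
    (π * m * (1 + m^2))⁻¹ * (Real.exp (-((1 + m ^ 2) * t ^ 2) / 2) *
      ((t ^ 2)⁻¹ - (2 / (1 + m^2) + 1 / m^2) * (t ^ 4)⁻¹)) ≤ 1 - snCdf (-m) t := by
  have hpi := Real.pi_pos
  set K := 2 / (1 + m^2) + 1 / m^2 with hK
  have hK0 : 0 < K := by positivity
  suffices h : (π * m * (1 + m^2))⁻¹ * (Real.exp (-((1 + m ^ 2) * t ^ 2) / 2) *
      ((t ^ 2)⁻¹ - K * (t ^ 4)⁻¹)) - (1 - snCdf (-m) t) ≤ 0 by linarith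
  refine nonpos_of_deriv (D := fun t => (π * m * (1 + m^2))⁻¹ *
      (Real.exp (-((1 + m ^ 2) * t ^ 2) / 2) * ((t ^ 2)⁻¹ - K * (t ^ 4)⁻¹)) - (1 - snCdf (-m) t))
    (D' := fun t => (snPdf (-m) t -
        π⁻¹ * Real.exp (-((1 + m ^ 2) * t ^ 2) / 2) * ((m * t)⁻¹ - ((m * t)^3)⁻¹))
      + (π * m * (1 + m^2))⁻¹ * (Real.exp (-((1 + m ^ 2) * t ^ 2) / 2) * (4 * K * (t ^ 5)⁻¹)))
    ?_ ?_ ?_ t ht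
  · intro t ht
    refine ((((gauss_deriv (1 + m^2) t).mul ((inv_pow_deriv 2 t ht).sub
      ((inv_pow_deriv 4 t ht).const_mul K))).const_mul _).sub
      ((snCdf_deriv (-m) t).const_sub 1)).congr_deriv ?_
    simp
    rw [hK]
    field_simp; ring
  · intro t ht
    have := snPdf_lower m t hm ht
    have : 0 ≤ (π * m * (1 + m^2))⁻¹ *
        (Real.exp (-((1 + m ^ 2) * t ^ 2) / 2) * (4 * K * (t ^ 5)⁻¹)) := by
      positivity
    linarith
  · have := (((gauss_tendsto (1 + m^2) (by positivity)).mul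
      ((tendsto_pow_atTop (α := ℝ) (n := 2) two_ne_zero).inv_tendsto_atTop.sub
      ((tendsto_pow_atTop (α := ℝ) (n := 4) four_ne_zero).inv_tendsto_atTop.const_mul K))).const_mul
        (π * m * (1 + m^2))⁻¹).sub ((snCdf_tendsto (-m)).const_sub 1)
    simpa using this

lemma dslope_lim {ι : Type*} {f : Filter ι} {h : ℝ → ℝ} {h' b : ℝ} (hd : HasDerivAt h h' 0)
    (h0 : h 0 = 0) {p r : ι → ℝ} (hp : Tendsto p f (𝓝 0))
    (hpr : Tendsto (fun i => p i / r i) f (𝓝 b)) :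
    Tendsto (fun i => h (p i) / r i) f (𝓝 (b * h')) := by
  have hc : ContinuousAt (dslope h 0) 0 := continuousAt_dslope_same.2 hd.differentiableAt
  have h1 : Tendsto (fun i => dslope h 0 (p i)) f (𝓝 h') := by
    have := hc.tendsto.comp hp
    rw [dslope_same, hd.deriv] at this
    exact this
  refine (hpr.mul h1).congr fun i => ?_
  have := sub_smul_dslope h 0 (p i)
  rw [h0, sub_zero, sub_zero, smul_eq_mul] at this
  rw [← this]; ring

lemma pow_limit {τ r : ℕ → ℝ} {e : ℝ}
    (hτ : Tendsto (fun n => (τ n - e) / r n) atTop (𝓝 (-e)))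
    (hr : Tendsto r atTop (𝓝 0)) (hr0 : ∀ᶠ n in atTop, 0 < r n)
    (hnr : Tendsto (fun n : ℕ => 1 / ((n : ℝ) * r n)) atTop (𝓝 0)) :
    Tendsto (fun n : ℕ => ((1 - τ n / n) ^ n - Real.exp (-e)) / r n) atTop
      (𝓝 (Real.exp (-e) * e)) := by
  have hτe : Tendsto τ atTop (𝓝 e) := by
    have := (hτ.mul hr).const_add e
    rw [mul_zero, add_zero] at this
    refine this.congr' ?_
    filter_upwards [hr0] with n hn
    field_simp; ring
  have hq : Tendsto (fun n : ℕ => τ n / n) atTop (𝓝 0) :=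
    hτe.div_atTop tendsto_natCast_atTop_atTop
  have hq1 : ∀ᶠ n : ℕ in atTop, τ n / n < 1 := hq.eventually_lt_const (by norm_num)
  have hup : Tendsto (fun n => -((τ n - e) / r n)) atTop (𝓝 e) := by simpa using hτ.neg
  have hlo : Tendsto (fun n : ℕ => -((τ n - e) / r n)
      - τ n * τ n * (1 - τ n / n)⁻¹ * (1 / ((n : ℝ) * r n))) atTop (𝓝 e) := by
    have h1 : Tendsto (fun n : ℕ => (1 - τ n / n)⁻¹) atTop (𝓝 1) := by
      have := (hq.const_sub 1).inv₀ (by norm_num)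
      simpa using this
    have := hup.sub (((hτe.mul hτe).mul h1).mul hnr)
    simpa using this
  have hP : Tendsto (fun n : ℕ => ((n : ℝ) * Real.log (1 - τ n / n) + e) / r n) atTop (𝓝 e) := by
    refine tendsto_of_tendsto_of_tendsto_of_le_of_le' hlo hup ?_ ?_
    · filter_upwards [hr0, hq1, eventually_gt_atTop 0] with n hr hq hn
      have hn' : (0:ℝ) < n := by exact_mod_cast hn
      have h1 : 0 < 1 - τ n / n := by linarith
      have := one_sub_inv_le_log_of_pos h1
      have h2 : (n : ℝ) * (1 - (1 - τ n / n)⁻¹) ≤ n * Real.log (1 - τ n / n) := by gcongr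
      have h3 : (n : ℝ) * (1 - (1 - τ n / n)⁻¹) = - τ n - τ n * τ n * (1 - τ n / n)⁻¹ / n := by
        set y := 1 - τ n / n with hy
        have : τ n = n * (1 - y) := by rw [hy]; field_simp; ring
        rw [this]; field_simp; ring
      rw [le_div_iff₀ hr]
      have h4 : (-((τ n - e) / r n) - τ n * τ n * (1 - τ n / n)⁻¹ * (1 / ((n : ℝ) * r n))) * r n
          = - τ n - τ n * τ n * (1 - τ n / n)⁻¹ / n + e := by
        generalize (1 - τ n / n)⁻¹ = y
        field_simp; ring
      rw [h4]; linarith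
    · filter_upwards [hr0, hq1, eventually_gt_atTop 0] with n hr hq hn
      have hn' : (0:ℝ) < n := by exact_mod_cast hn
      have h1 : 0 < 1 - τ n / n := by linarith
      have := Real.log_le_sub_one_of_pos h1
      have h2 : n * Real.log (1 - τ n / n) ≤ (n : ℝ) * (1 - τ n / n - 1) := by gcongr
      have h3 : (n : ℝ) * (1 - τ n / n - 1) = - τ n := by field_simp; ring
      rw [← neg_div]
      gcongr
      linarith
  have hP0 : Tendsto (fun n : ℕ => ((n : ℝ) * Real.log (1 - τ n / n) + e)) atTop (𝓝 0) := by
    have := hP.mul hr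
    rw [mul_zero] at this
    refine this.congr' ?_
    filter_upwards [hr0] with n hn
    field_simp
  have hd : HasDerivAt (fun p => Real.exp p - 1) 1 0 := by
    simpa using (Real.hasDerivAt_exp 0).sub_const 1
  have := (dslope_lim hd (by simp) hP0 hP).const_mul (Real.exp (-e))
  rw [mul_one] at this
  refine this.congr' ?_
  filter_upwards [hq1] with n hq
  have h1 : 0 < 1 - τ n / n := by linarith
  rw [Real.exp_add, mul_comm (n : ℝ), Real.exp_mul, Real.exp_log h1, Real.rpow_natCast]
  have : Real.exp (-e) * Real.exp e = 1 := by rw [← Real.exp_add]; simp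
  rw [← mul_div_assoc]
  congr 1
  linear_combination (1 - τ n / n) ^ n * this

lemma loglog_lims (x b : ℝ) :
    Tendsto (fun L : ℝ => (Real.log L)^2 / (4 * L)) atTop (𝓝 0) ∧
    Tendsto (fun L : ℝ => (x - (Real.log L + b)) / Real.log L) atTop (𝓝 (-1)) ∧
    Tendsto (fun L : ℝ => 1 / Real.log L) atTop (𝓝 0) := by
  have h3 : Tendsto (fun L : ℝ => 1 / Real.log L) atTop (𝓝 0) := by
    simp only [one_div]
    exact tendsto_log_atTop.inv_tendsto_atTop
  refine ⟨?_, ?_, h3⟩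
  · have := (isLittleO_pow_log_id_atTop (n := 2)).tendsto_div_nhds_zero.const_mul (1/4)
    rw [mul_zero] at this
    refine this.congr fun L => ?_
    simp only [id]
    rw [mul_comm 4 L, ← div_div]; ring
  · have := (h3.const_mul (x - b)).sub_const 1
    rw [mul_zero, zero_sub] at this
    refine this.congr' ?_
    filter_upwards [eventually_gt_atTop 1] with L hL
    have := Real.log_pos hL
    field_simp; ring

lemma main_lims (x b : ℝ) :
    Tendsto (fun L : ℝ => (x - (Real.log L + b)) / (2 * L)) atTop (𝓝 0) ∧
    Tendsto (fun L : ℝ => (Real.exp (-(L * ((x - (Real.log L + b)) / (2 * L))^2)) *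
      ((1 + (x - (Real.log L + b)) / (2 * L)) ^ 2)⁻¹ - 1) / ((Real.log L)^2 / (4 * L))) atTop
      (𝓝 (-1)) := by
  obtain ⟨hr, hd, hl⟩ := loglog_lims x b
  have hwr : Tendsto (fun L : ℝ => ((x - (Real.log L + b)) / (2 * L)) / ((Real.log L)^2 / (4 * L)))
      atTop (𝓝 0) := by
    have := (hd.mul hl).const_mul 2
    rw [mul_zero, mul_zero] at this
    refine this.congr' ?_
    filter_upwards [eventually_gt_atTop 1] with L hL
    have := Real.log_pos hL
    field_simp; ring
  have hw : Tendsto (fun L : ℝ => (x - (Real.log L + b)) / (2 * L)) atTop (𝓝 0) := by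
    have := hwr.mul hr
    rw [mul_zero] at this
    refine this.congr' ?_
    filter_upwards [eventually_gt_atTop 1] with L hL
    have := Real.log_pos hL
    field_simp
  have hvr : Tendsto (fun L : ℝ => (-(L * ((x - (Real.log L + b)) / (2 * L))^2)) /
      ((Real.log L)^2 / (4 * L))) atTop (𝓝 (-1)) := by
    have := (hd.mul hd).neg
    rw [show -((-1:ℝ) * (-1)) = -1 by norm_num] at this
    refine this.congr' ?_
    filter_upwards [eventually_gt_atTop 1] with L hL
    have := Real.log_pos hL
    field_simp; ring
  have hv : Tendsto (fun L : ℝ => (-(L * ((x - (Real.log L + b)) / (2 * L))^2))) atTop (𝓝 0) := by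
    have := hvr.mul hr
    rw [mul_zero] at this
    refine this.congr' ?_
    filter_upwards [eventually_gt_atTop 1] with L hL
    have := Real.log_pos hL
    field_simp
  refine ⟨hw, ?_⟩
  have he : HasDerivAt (fun p => Real.exp p - 1) 1 0 := by
    simpa using (Real.hasDerivAt_exp 0).sub_const 1
  have hi : HasDerivAt (fun p : ℝ => ((1 + p)^2)⁻¹ - 1) (-2) 0 := by
    have h1 : HasDerivAt (fun p : ℝ => 1 + p) 1 0 := (hasDerivAt_id (0:ℝ)).const_add 1
    refine (((h1.pow 2).inv (by norm_num)).sub_const 1).congr_deriv ?_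
    norm_num
  have h1 := dslope_lim he (by simp) hv hvr
  have h2 := dslope_lim hi (by simp) hw hwr
  have h3 : Tendsto (fun L : ℝ => ((1 + (x - (Real.log L + b)) / (2 * L)) ^ 2)⁻¹) atTop (𝓝 1) := by
    have := ((hw.const_add 1).pow 2).inv₀ (by norm_num)
    simpa using this
  have := (h1.mul h3).add h2
  rw [show (-1:ℝ) * 1 * 1 + 0 * -2 = -1 by norm_num] at this
  refine this.congr fun L => ?_
  ring

lemma z_eq (m x b L : ℝ) (hL : 0 < L) :
    (Real.sqrt (1 + m ^ 2))⁻¹ * (Real.sqrt (2 * L))⁻¹ * x +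
        (Real.sqrt (2 * L / (1 + m ^ 2)) -
          (Real.log L + b) / (Real.sqrt (1 + m ^ 2) * Real.sqrt (2 * L)))
    = Real.sqrt (2 * L) * (1 + (x - (Real.log L + b)) / (2 * L)) / Real.sqrt (1 + m^2) := by
  rw [Real.sqrt_div (by positivity)]
  have h1 : √(2 * L) ^ 2 = 2 * L := Real.sq_sqrt (by positivity)
  have h2 : 0 < √(2 * L) := by positivity
  have h3 : 0 < √(1 + m^2) := by positivity
  rw [show (x - (Real.log L + b)) / (2 * L) = (x - (Real.log L + b)) / (√(2 * L) ^ 2) by rw [h1]]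
  field_simp
  ring

lemma G_eq (m x L w z : ℝ) (hm : 0 < m) (hL : 0 < L) (hw : 0 < 1 + w)
    (hwd : w = (x - (Real.log L + Real.log (2 * π * m))) / (2 * L))
    (hz : z ^ 2 = 2 * L * (1 + w)^2 / (1 + m^2)) :
    (π * m * (1 + m^2))⁻¹ * (Real.exp (-((1 + m ^ 2) * z ^ 2) / 2) * (z ^ 2)⁻¹) =
      (Real.exp L)⁻¹ * (Real.exp (-x) * (Real.exp (-(L * w^2)) * ((1 + w)^2)⁻¹)) := by
  have hpi := Real.pi_pos
  have h1 : -((1 + m ^ 2) * z ^ 2) / 2 =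
      -L + -x + Real.log L + Real.log (2 * π * m) + -(L * w^2) := by
    have : 2 * L * w = (x - (Real.log L + Real.log (2 * π * m))) := by rw [hwd]; field_simp
    have h2 : (1 + m^2) * z^2 = 2 * L * (1 + w)^2 := by rw [hz]; field_simp
    rw [h2]
    linear_combination -this
  rw [h1, Real.exp_add, Real.exp_add, Real.exp_add, Real.exp_add, Real.exp_log hL,
    Real.exp_log (by positivity), hz, Real.exp_neg L]
  field_simp

theorem skew_normal_rate_neg (l : ℝ) (hl : l < 0) (x : ℝ) :
    Tendsto (fun n : ℕ =>
      ((snCdf l ((Real.sqrt (1 + l ^ 2))⁻¹ * (Real.sqrt (2 * Real.log n))⁻¹ * x +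
        (Real.sqrt (2 * Real.log n / (1 + l ^ 2)) -
          (Real.log (Real.log n) + Real.log (-2 * Real.pi * l)) /
            (Real.sqrt (1 + l ^ 2) * Real.sqrt (2 * Real.log n))))) ^ n - gumbel x) *
        (4 * Real.log n) / (Real.log (Real.log n)) ^ 2) atTop
      (𝓝 (gumbel x * Real.exp (-x))) := by
  obtain ⟨m, rfl⟩ : ∃ m, l = -m := ⟨-l, by ring⟩
  have hm : 0 < m := by linarith
  rw [show -2 * π * -m = 2 * π * m by ring, show 1 + (-m)^2 = 1 + m^2 by ring]
  set b := Real.log (2 * π * m) with hb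
  set z : ℕ → ℝ := fun n => (Real.sqrt (1 + m ^ 2))⁻¹ * (Real.sqrt (2 * Real.log n))⁻¹ * x +
        (Real.sqrt (2 * Real.log n / (1 + m ^ 2)) -
          (Real.log (Real.log n) + b) /
            (Real.sqrt (1 + m ^ 2) * Real.sqrt (2 * Real.log n))) with hz
  have hLn : Tendsto (fun n : ℕ => Real.log n) atTop atTop :=
    tendsto_log_atTop.comp tendsto_natCast_atTop_atTop
  obtain ⟨hw, hq⟩ := main_lims x b
  obtain ⟨hr, -, hl⟩ := loglog_lims x b
  replace hw := hw.comp hLn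
  replace hq := hq.comp hLn
  replace hr := hr.comp hLn
  replace hl := hl.comp hLn
  set r : ℕ → ℝ := fun n => (Real.log (Real.log n))^2 / (4 * Real.log n) with hrdef
  set w : ℕ → ℝ := fun n => (x - (Real.log (Real.log n) + b)) / (2 * Real.log n) with hwdef
  have hw' : Tendsto w atTop (𝓝 0) := hw
  have hr' : Tendsto r atTop (𝓝 0) := hr
  have hL1 : ∀ᶠ n : ℕ in atTop, 1 < Real.log n := hLn.eventually_gt_atTop 1
  have hr0 : ∀ᶠ n in atTop, 0 < r n := by
    filter_upwards [hL1] with n hn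
    have := Real.log_pos hn
    simp only [hrdef]; positivity
  set Q : ℕ → ℝ := fun n => Real.exp (-(Real.log n * (w n)^2)) * ((1 + w n) ^ 2)⁻¹ with hQ
  have hq' : Tendsto (fun n => (Q n - 1) / r n) atTop (𝓝 (-1)) := hq
  have hQ1 : Tendsto Q atTop (𝓝 1) := by
    have := (hq'.mul hr').const_add 1
    rw [mul_zero, add_zero] at this
    refine this.congr' ?_
    filter_upwards [hr0] with n hn
    field_simp; ring
  have hLr : Tendsto (fun n : ℕ => (1 / Real.log n) / r n) atTop (𝓝 0) := by
    have := (hl.mul hl).const_mul 4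
    rw [mul_zero, mul_zero] at this
    refine this.congr' ?_
    filter_upwards [hL1] with n hn
    have := Real.log_pos hn
    simp only [hrdef, Function.comp]
    field_simp
  have hnr : Tendsto (fun n : ℕ => 1 / ((n : ℝ) * r n)) atTop (𝓝 0) := by
    have h1 : Tendsto (fun n : ℕ => Real.log n / (n : ℝ)) atTop (𝓝 0) :=
      isLittleO_log_id_atTop.tendsto_div_nhds_zero.comp tendsto_natCast_atTop_atTop
    have := h1.mul hLr
    rw [mul_zero] at this
    refine this.congr' ?_
    filter_upwards [hL1, hr0, eventually_gt_atTop 0] with n hn hr hn0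
    have : (0:ℝ) < n := by exact_mod_cast hn0
    field_simp
  set K := 2 / (1 + m^2) + 1 / m^2 with hK
  have hw1 : ∀ᶠ n in atTop, -1 < w n := hw'.eventually_const_lt (by norm_num)
  have hbounds : ∀ᶠ n : ℕ in atTop,
      n * (1 - snCdf (-m) (z n)) ≤ Real.exp (-x) * Q n ∧
      Real.exp (-x) * Q n * (1 - K * (1 + m^2) / 2 * ((1 + w n)^2)⁻¹ * (1 / Real.log n))
        ≤ n * (1 - snCdf (-m) (z n)) := by
    filter_upwards [hL1, hw1, eventually_gt_atTop 0] with n hn hwn hn0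
    have hn' : (0:ℝ) < n := by exact_mod_cast hn0
    have hL0 : 0 < Real.log n := by linarith
    have hwp : 0 < 1 + w n := by linarith
    have hze : z n = Real.sqrt (2 * Real.log n) * (1 + w n) / Real.sqrt (1 + m^2) :=
      z_eq m x b (Real.log n) hL0
    have hzp : 0 < z n := by rw [hze]; positivity
    have hz2 : z n ^ 2 = 2 * Real.log n * (1 + w n)^2 / (1 + m^2) := by
      rw [hze, div_pow, mul_pow, Real.sq_sqrt (by positivity), Real.sq_sqrt (by positivity)]
    have hG := G_eq m x (Real.log n) (w n) (z n) hm hL0 hwp rfl hz2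
    rw [Real.exp_log hn'] at hG
    have hu := tail_upper m (z n) hm hzp
    have hlo := tail_lower m (z n) hm hzp
    rw [hG] at hu
    have hlo2 : (n:ℝ)⁻¹ * (Real.exp (-x) * Q n) *
        (1 - K * (1 + m^2) / 2 * ((1 + w n)^2)⁻¹ * (1 / Real.log n)) ≤ 1 - snCdf (-m) (z n) := by
      refine le_trans (le_of_eq ?_) hlo
      simp only [hQ]
      rw [← hG, ← hK]
      have : (z n ^ 4)⁻¹ = (z n ^ 2)⁻¹ * ((1 + m^2) / 2 * ((1 + w n)^2)⁻¹ * (1 / Real.log n)) := by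
        rw [show z n ^ 4 = z n ^ 2 * z n ^ 2 by ring, hz2]
        field_simp
      rw [this]; ring
    constructor
    · calc _ ≤ (n:ℝ) * ((n:ℝ)⁻¹ * (Real.exp (-x) * Q n)) := by gcongr
        _ = _ := by field_simp
    · calc _ = (n:ℝ) * ((n:ℝ)⁻¹ * (Real.exp (-x) * Q n) *
        (1 - K * (1 + m^2) / 2 * ((1 + w n)^2)⁻¹ * (1 / Real.log n))) := by field_simp
        _ ≤ _ := by gcongr
  have hτ : Tendsto (fun n : ℕ => ((n * (1 - snCdf (-m) (z n))) - Real.exp (-x)) / r n) atTop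
      (𝓝 (-Real.exp (-x))) := by
    have hup : Tendsto (fun n => Real.exp (-x) * ((Q n - 1) / r n)) atTop (𝓝 (-Real.exp (-x))) := by
      simpa using hq'.const_mul (Real.exp (-x))
    have h3 : Tendsto (fun n => ((1 + w n) ^ 2)⁻¹) atTop (𝓝 1) := by
      have := ((hw'.const_add 1).pow 2).inv₀ (by norm_num)
      simpa using this
    have hlo : Tendsto (fun n : ℕ => Real.exp (-x) * ((Q n - 1) / r n) -
        Real.exp (-x) * (Q n * (K * (1 + m^2) / 2 * (((1 + w n)^2)⁻¹ * ((1 / Real.log n) / r n)))))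
        atTop (𝓝 (-Real.exp (-x))) := by
      have := hup.sub ((hQ1.mul ((h3.mul hLr).const_mul (K * (1 + m^2) / 2))).const_mul
        (Real.exp (-x)))
      simpa only [mul_zero, sub_zero] using this
    refine tendsto_of_tendsto_of_tendsto_of_le_of_le' hlo hup ?_ ?_
    · filter_upwards [hbounds, hr0] with n hn hr
      rw [le_div_iff₀ hr]
      refine le_trans (le_of_eq ?_) (sub_le_sub_right hn.2 _)
      generalize ((1 + w n)^2)⁻¹ = y
      generalize 1 / Real.log n = y'
      field_simp
      ring
    · filter_upwards [hbounds, hr0] with n hn hr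
      rw [div_le_iff₀ hr]
      refine le_trans (sub_le_sub_right hn.1 _) (le_of_eq ?_)
      field_simp
  have := pow_limit hτ hr' hr0 hnr
  refine this.congr' ?_
  filter_upwards [hL1, eventually_gt_atTop 0] with n hn hn0
  have hn' : (0:ℝ) < n := by exact_mod_cast hn0
  have hll := Real.log_pos hn
  have hs : 1 - n * (1 - snCdf (-m) (z n)) / n = snCdf (-m) (z n) := by field_simp; ring
  rw [hs]
  simp only [hrdef, gumbel]
  rw [div_div_eq_mul_div]
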